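/- Let D̂ = d_* − ∂ + (1/2)(X₀∧ + ι_{ξ₀}) + τ∧ − ι_φ be the operator on ∧•g for a proto-bialgebra (g, g*, τ, φ) over a point. Then for all x + ξ, y + η ∈ g ⊕ g*, the double graded commutator [[D̂, x + ξ], y + η], as an operator on ∧•g, is the Clifford action of the element ([x,y]_g + ad*_ξ y − ad*_η x − ι_ηι_ξτ) + ([ξ,η]_* + ad*_x η − ad*_y ξ − ι_yι_xφ) of g ⊕ g*; i.e. the derived bracket of D̂ recovers the Dorfman bracket of the Courant (quadratic Lie) algebra g ⊕ g*. -/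

import Mathlib

set_option synthInstance.maxHeartbeats 1000000
set_option maxHeartbeats 1000000

noncomputable section

open ExteriorAlgebra Module MulOpposite

variable {R : Type*} {M W : Type*} [CommRing R] [AddCommGroup M] [Module R M]
  [AddCommGroup W] [Module R W]

/-- Contraction of a multivector by a single covector. -/
def ctr (ξ : Module.Dual R M) : ExteriorAlgebra R M →ₗ[R] ExteriorAlgebra R M :=
  CliffordAlgebra.contractLeft ξ

/-- Contraction of elements of `⋀ M` by multivectors built on `W`, where vectors of `W`
act through the pairing `p`.  This is an algebra morphism into the opposite endomorphism
algebra, so that `ι_{w₁ ∧ w₂} = ι_{w₂} ∘ ι_{w₁}`. -/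
def mctrAux (p : W →ₗ[R] Module.Dual R M) :
    ExteriorAlgebra R W →ₐ[R] (Module.End R (ExteriorAlgebra R M))ᵐᵒᵖ :=
  ExteriorAlgebra.lift R ⟨((MulOpposite.opLinearEquiv R).toLinearMap.comp
      ((CliffordAlgebra.contractLeft (Q := (0 : QuadraticForm R M))).comp p)), fun w => by
    apply MulOpposite.unop_injective
    apply LinearMap.ext
    intro x
    simpa using CliffordAlgebra.contractLeft_contractLeft (d := p w) (x := x)⟩

variable (R M)

/-- Contraction of multivectors by exterior forms. -/
def mctrF : ExteriorAlgebra R (Module.Dual R M) →ₐ[R]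
    (Module.End R (ExteriorAlgebra R M))ᵐᵒᵖ :=
  mctrAux (LinearMap.id)

/-- Contraction of exterior forms by multivectors. -/
def mctrV : ExteriorAlgebra R M →ₐ[R]
    (Module.End R (ExteriorAlgebra R (Module.Dual R M)))ᵐᵒᵖ :=
  mctrAux (Module.Dual.eval R M)

variable {R M}

/-- The full pairing `⟨ω | r⟩` of an exterior form against a multivector, given by the
scalar part of the full contraction of `r` by `ω`. -/
def epair (ω : ExteriorAlgebra R (Module.Dual R M)) (r : ExteriorAlgebra R M) : R :=
  algebraMapInv ((mctrF R M ω).unop r)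

/-- Contraction of forms by a single vector. -/
def ctrv (x : M) : ExteriorAlgebra R (Module.Dual R M) →ₗ[R]
    ExteriorAlgebra R (Module.Dual R M) :=
  CliffordAlgebra.contractLeft (Module.Dual.eval R M x)


namespace Stmt19

open ExteriorAlgebra Module

variable {g : Type*} [AddCommGroup g] [Module ℝ g]

/-- `Ω^♯(r) = ι_r Ω`. -/
noncomputable def osharp (Ω : ExteriorAlgebra ℝ (Module.Dual ℝ g))
    (r : ExteriorAlgebra ℝ g) : ExteriorAlgebra ℝ (Module.Dual ℝ g) :=
  (mctrV ℝ g r).unop Ω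

/-- `V^♯(ω) = ι_ω V`. -/
noncomputable def vsharp (Vt : ExteriorAlgebra ℝ g)
    (ω : ExteriorAlgebra ℝ (Module.Dual ℝ g)) : ExteriorAlgebra ℝ g :=
  (mctrF ℝ g ω).unop Vt


section Helpers

variable {R : Type*} {M W : Type*} [CommRing R] [AddCommGroup M] [Module R M]
  [AddCommGroup W] [Module R W]

lemma deg_ind {P : ℕ → ExteriorAlgebra R M → Prop}
    (h0 : ∀ r : R, P 0 (algebraMap R _ r))
    (hadd : ∀ k x y, P k x → P k y → P k (x + y))
    (hmul : ∀ k (m : M) x, x ∈ ⋀[R]^k M → P k x → P (k + 1) (ι R m * x))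
    {k : ℕ} {x : ExteriorAlgebra R M} (hx : x ∈ ⋀[R]^k M) : P k x := by
  refine Submodule.pow_induction_on_left' (LinearMap.range (ι R (M := M)))
    (C := fun k x _ => P k x) h0 (fun x y i _ _ => hadd i x y) ?_ hx
  rintro _ ⟨m, rfl⟩ i x hx h
  exact hmul i m x hx h

lemma ι_mem (m : M) : ι R m ∈ ⋀[R]^1 M := by
  simp [exteriorPower]

lemma algebraMap_mem0 (r : R) : algebraMap R (ExteriorAlgebra R M) r ∈ ⋀[R]^0 M := by
  simp [exteriorPower]

lemma mem0 {r : ExteriorAlgebra R M} (h : r ∈ ⋀[R]^0 M) : ∃ c : R, r = algebraMap R _ c := by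
  rw [exteriorPower, pow_zero, Submodule.mem_one] at h
  obtain ⟨c, hc⟩ := h
  exact ⟨c, hc.symm⟩

lemma mem1 {r : ExteriorAlgebra R M} (h : r ∈ ⋀[R]^1 M) : ∃ m : M, r = ι R m := by
  rw [exteriorPower, pow_one] at h
  obtain ⟨c, hc⟩ := h
  exact ⟨c, hc.symm⟩

lemma ι_mul_mem {k : ℕ} (m : M) {r : ExteriorAlgebra R M} (h : r ∈ ⋀[R]^k M) :
    ι R m * r ∈ ⋀[R]^(k+1) M := by
  rw [exteriorPower, pow_succ']
  exact Submodule.mul_mem_mul ⟨m, rfl⟩ h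

lemma ι_swap (x y : M) : ι R x * ι R y = - (ι R y * ι R x) :=
  eq_neg_of_add_eq_zero_left (ι_add_mul_swap x y)

lemma ι_comm {k : ℕ} {r : ExteriorAlgebra R M} (h : r ∈ ⋀[R]^k M) (x : M) :
    ι R x * r = (-1 : R)^k • (r * ι R x) := by
  refine deg_ind (P := fun k r => ι R x * r = (-1 : R)^k • (r * ι R x)) ?_ ?_ ?_ h
  · intro r
    simp [Algebra.commutes]
  · intro k a b ha hb
    rw [mul_add, add_mul, ha, hb, smul_add]
  · intro k m a _ ih
    rw [← mul_assoc, ι_swap, neg_mul, mul_assoc, ih, pow_succ, mul_assoc]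
    simp

lemma ctr_ι_mul (ξ : Module.Dual R M) (x : M) (v : ExteriorAlgebra R M) :
    ctr ξ (ι R x * v) = ξ x • v - ι R x * ctr ξ v :=
  CliffordAlgebra.contractLeft_ι_mul ..

lemma ctr_algebraMap (ξ : Module.Dual R M) (c : R) :
    ctr ξ (algebraMap R (ExteriorAlgebra R M) c) = 0 :=
  CliffordAlgebra.contractLeft_algebraMap ..

lemma ctr_one (ξ : Module.Dual R M) :
    ctr ξ (1 : ExteriorAlgebra R M) = 0 :=
  CliffordAlgebra.contractLeft_one ..

lemma ctr_ι (ξ : Module.Dual R M) (x : M) :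
    ctr ξ (ι R x) = algebraMap R _ (ξ x) :=
  CliffordAlgebra.contractLeft_ι ..

lemma ctr_comm (ξ η : Module.Dual R M) (v : ExteriorAlgebra R M) :
    ctr ξ (ctr η v) = - ctr η (ctr ξ v) :=
  CliffordAlgebra.contractLeft_comm ..

lemma ctr_mul (ξ : Module.Dual R M) {k : ℕ} {r : ExteriorAlgebra R M} (h : r ∈ ⋀[R]^k M)
    (v : ExteriorAlgebra R M) :
    ctr ξ (r * v) = ctr ξ r * v + (-1 : R)^k • (r * ctr ξ v) := by
  refine deg_ind (P := fun k r => ctr ξ (r * v) = ctr ξ r * v + (-1 : R)^k • (r * ctr ξ v))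
    ?_ ?_ ?_ h
  · intro r
    simp [ctr_algebraMap, ← Algebra.smul_def]
  · intro k a b ha hb
    rw [add_mul, map_add, map_add, ha, hb, add_mul, add_mul, smul_add]; abel
  · intro k m a _ ih
    rw [mul_assoc, ctr_ι_mul, ih, ctr_ι_mul, pow_succ, mul_add, sub_mul]
    simp [mul_assoc]
    abel

lemma ctr_mem0 (ξ : Module.Dual R M) {r : ExteriorAlgebra R M} (h : r ∈ ⋀[R]^0 M) :
    ctr ξ r = 0 := by
  obtain ⟨c, rfl⟩ := mem0 h
  exact ctr_algebraMap ..

lemma ctr_mem (ξ : Module.Dual R M) {k : ℕ} {r : ExteriorAlgebra R M} (h : r ∈ ⋀[R]^(k+1) M) :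
    ctr ξ r ∈ ⋀[R]^k M := by
  have := deg_ind (P := fun k r => (∀ j, k = j + 1 → ctr ξ r ∈ ⋀[R]^j M)) ?_ ?_ ?_ h
  · exact this k rfl
  · intro r j hj; omega
  · intro k a b ha hb j hj
    rw [map_add]
    exact add_mem (ha j hj) (hb j hj)
  · intro k m a hka ih j hj
    obtain rfl : k = j := by omega
    rw [ctr_ι_mul]
    refine sub_mem (Submodule.smul_mem _ _ hka) ?_
    rcases k with _ | k
    · rw [ctr_mem0 ξ hka]; simp
    · exact ι_mul_mem _ (ih k rfl)

lemma end_ext {K : Module.End R (ExteriorAlgebra R M)} (h1 : K 1 = 0)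
    (hm : ∀ m v, K v = 0 → K (ι R m * v) = 0) : ∀ v, K v = 0 := by
  intro v
  induction v using CliffordAlgebra.left_induction with
  | algebraMap r => rw [Algebra.algebraMap_eq_smul_one, map_smul, h1, smul_zero]
  | add x y hx hy => rw [map_add, hx, hy, add_zero]
  | ι_mul x m hx => exact hm m x hx

/-- contraction operator -/
def pc (p : W →ₗ[R] Module.Dual R M) (ω : ExteriorAlgebra R W) :
    Module.End R (ExteriorAlgebra R M) := (mctrAux p ω).unop

lemma pc_ι (p : W →ₗ[R] Module.Dual R M) (w : W) (v : ExteriorAlgebra R M) :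
    pc p (ι R w) v = ctr (p w) v := by
  simp [pc, mctrAux, ctr]

lemma pc_mul (p : W →ₗ[R] Module.Dual R M) (a b : ExteriorAlgebra R W)
    (v : ExteriorAlgebra R M) : pc p (a * b) v = pc p b (pc p a v) := by
  simp [pc]

lemma pc_add (p : W →ₗ[R] Module.Dual R M) (a b : ExteriorAlgebra R W) :
    pc p (a + b) = pc p a + pc p b := by
  simp [pc]

lemma pc_sub (p : W →ₗ[R] Module.Dual R M) (a b : ExteriorAlgebra R W) :
    pc p (a - b) = pc p a - pc p b := by
  simp [pc]

lemma pc_zero (p : W →ₗ[R] Module.Dual R M) : pc p 0 = 0 := by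
  simp [pc]

lemma pc_smul (p : W →ₗ[R] Module.Dual R M) (c : R) (a : ExteriorAlgebra R W) :
    pc p (c • a) = c • pc p a := by
  simp [pc]

lemma pc_algebraMap (p : W →ₗ[R] Module.Dual R M) (c : R) :
    pc p (algebraMap R _ c) = c • 1 := by
  rw [Algebra.algebraMap_eq_smul_one, pc_smul]
  simp [pc]

lemma pc_ι_mul (p : W →ₗ[R] Module.Dual R M) {k : ℕ} {ω : ExteriorAlgebra R W}
    (h : ω ∈ ⋀[R]^k W) (x : M) : ∀ (v : ExteriorAlgebra R M),
    pc p ω (ι R x * v) = (-1 : R)^k • (ι R x * pc p ω v) + pc p (ctr (p.flip x) ω) v := by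
  refine deg_ind (P := fun k ω => ∀ v, pc p ω (ι R x * v)
    = (-1 : R)^k • (ι R x * pc p ω v) + pc p (ctr (p.flip x) ω) v) ?_ ?_ ?_ h
  · intro r v
    simp [ctr_algebraMap, pc_algebraMap, pc_zero]
  · intro k a b ha hb v
    rw [map_add, pc_add, pc_add, LinearMap.add_apply, LinearMap.add_apply, LinearMap.add_apply,
      ha, hb, mul_add, smul_add]; abel
  · intro k m a _ ih v
    rw [pc_mul, pc_ι, ctr_ι_mul, map_sub, ih, ctr_ι_mul, pc_sub, pc_smul, map_smul]
    rw [LinearMap.sub_apply, pc_mul, pc_mul, pc_ι, pow_succ]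
    simp
    abel

lemma pc_mem (p : W →ₗ[R] Module.Dual R M) {k : ℕ} {ω : ExteriorAlgebra R W}
    (h : ω ∈ ⋀[R]^k W) : ∀ (j : ℕ) (v : ExteriorAlgebra R M), v ∈ ⋀[R]^(j + k) M →
      pc p ω v ∈ ⋀[R]^j M := by
  refine deg_ind (P := fun k ω => ∀ (j : ℕ) (v : ExteriorAlgebra R M), v ∈ ⋀[R]^(j + k) M →
      pc p ω v ∈ ⋀[R]^j M) ?_ ?_ ?_ h
  · intro r j v hv
    rw [pc_algebraMap]
    exact Submodule.smul_mem _ _ hv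
  · intro k a b ha hb j v hv
    rw [pc_add]
    exact add_mem (ha j v hv) (hb j v hv)
  · intro k m a _ ih j v hv
    rw [pc_mul, pc_ι]
    exact ih j _ (ctr_mem _ hv)

lemma pc_ctr (p : W →ₗ[R] Module.Dual R M) {k : ℕ} {ω : ExteriorAlgebra R W}
    (h : ω ∈ ⋀[R]^k W) (w : W) (v : ExteriorAlgebra R M) :
    pc p ω (ctr (p w) v) = (-1 : R)^k • ctr (p w) (pc p ω v) := by
  rw [← pc_ι, ← pc_mul, ι_comm h, pc_smul, LinearMap.smul_apply, pc_mul, pc_ι]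

/-- The double commutator -/
def Qc {A : Type*} [Ring A] (D a b : A) : A := (D * a + a * D) * b - b * (D * a + a * D)

lemma Qc_expand {A : Type*} [Ring A] (D a b c d : A) :
    Qc D (a + b) (c + d) = Qc D a c + Qc D a d + Qc D b c + Qc D b d := by
  unfold Qc; noncomm_ring

lemma Qc_add {A : Type*} [Ring A] (D E a b : A) :
    Qc (D + E) a b = Qc D a b + Qc E a b := by
  unfold Qc; noncomm_ring

lemma Qc_sub {A : Type*} [Ring A] (D E a b : A) :
    Qc (D - E) a b = Qc D a b - Qc E a b := by
  unfold Qc; noncomm_ring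

lemma Qc_smul {A : Type*} [Ring A] [Algebra R A] (c : R) (D a b : A) :
    Qc (c • D) a b = c • Qc D a b := by
  unfold Qc; simp [smul_sub, mul_add, add_mul]

/-- wedge operator -/
abbrev wd (x : M) : Module.End R (ExteriorAlgebra R M) := LinearMap.mulLeft R (ι R x)

section der
variable {d : Module.End R (ExteriorAlgebra R M)} (h1 : d 1 = 0)
  (hd : ∀ x s, d (ι R x * s) = d (ι R x) * s - ι R x * d s)
  (h2 : ∀ x, d (ι R x) ∈ ⋀[R]^2 M)
include hd h2

lemma der_ww (x y : M) (v) : Qc d (wd x) (wd y) v = 0 := by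
  have := ι_comm (h2 x) y
  simp only [Qc, LinearMap.sub_apply, Module.End.mul_apply, LinearMap.add_apply,
    LinearMap.mulLeft_apply, hd x]
  simp at this
  rw [sub_add_cancel, sub_add_cancel, ← mul_assoc, ← mul_assoc, this, sub_self]

lemma der_wc (x : M) (η : Module.Dual R M) (v) :
    Qc d (wd x) (ctr η) v = - (ctr η (d (ι R x)) * v) := by
  simp only [Qc, LinearMap.sub_apply, Module.End.mul_apply, LinearMap.add_apply,
    LinearMap.mulLeft_apply, hd x]
  rw [sub_add_cancel, sub_add_cancel, ctr_mul η (h2 x)]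
  simp

lemma der_cw (y : M) (ξ : Module.Dual R M) (v) :
    Qc d (ctr ξ) (wd y) v = ctr ξ (d (ι R y)) * v := by
  simp only [Qc, LinearMap.sub_apply, Module.End.mul_apply, LinearMap.add_apply,
    LinearMap.mulLeft_apply, hd y, ctr_ι_mul, map_sub, ctr_mul ξ (h2 y), map_smul, mul_add]
  simp
  abel

include h1
lemma der_cc (ξ η f : Module.Dual R M)
    (hf : ∀ y, algebraMap R _ (f y) = - ctr η (ctr ξ (d (ι R y)))) (v) :
    Qc d (ctr ξ) (ctr η) v = ctr f v := by
  rw [← sub_eq_zero]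
  refine end_ext (K := Qc d (ctr ξ) (ctr η) - ctr f) ?_ ?_ v
  · simp [Qc, ctr_one, h1]
  · intro y v ih
    have h0 : (Qc d (ctr ξ) (ctr η) - ctr f) (ι R y * v)
       = - (ι R y * (Qc d (ctr ξ) (ctr η) - ctr f) v) := by
      simp only [Qc, LinearMap.sub_apply, Module.End.mul_apply, LinearMap.add_apply,
        hd y, ctr_ι_mul, map_sub, ctr_mul ξ (h2 y), map_smul, mul_add, mul_sub, map_add,
        ctr_mul η (ctr_mem ξ (h2 y)), ctr_mul η (h2 y), Algebra.smul_def (f y), hf]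
      simp
      abel
    rw [h0, ih, mul_zero, neg_zero]
end der

lemma extPow_eq_zero {K : Type*} {V : Type*} [Field K] [AddCommGroup V] [Module K V]
    [FiniteDimensional K V] {k : ℕ} (hk : Module.finrank K V < k) {r : ExteriorAlgebra K V}
    (h : r ∈ ⋀[K]^k V) : r = 0 := by
  rw [← ιMulti_span_fixedDegree] at h
  induction h using Submodule.span_induction with
  | mem x hx =>
    obtain ⟨v, rfl⟩ := hx
    apply AlternatingMap.map_linearDependent
    intro hl
    have := hl.fintype_card_le_finrank
    simp at this
    omega
  | zero => rfl
  | add x y _ _ hx hy => rw [hx, hy, add_zero]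
  | smul a x _ hx => rw [hx, smul_zero]

end Helpers

section Pieces

variable {R : Type*} {M : Type*} [CommRing R] [AddCommGroup M] [Module R M]

/-- Anticommutator -/
def Ac {A : Type*} [Ring A] (D a : A) : A := D * a + a * D

lemma Qc_Ac {A : Type*} [Ring A] (D a b : A) : Qc D a b = Ac D a * b - b * Ac D a := rfl

lemma flip_id_ctr (x : M) : ctr ((LinearMap.id : Module.Dual R M →ₗ[R] Module.Dual R M).flip x)
    = ctrv (R := R) x := rfl

lemma Q_wX (X x y : M) (ξ η : Module.Dual R M) (v) :
    Qc (wd X) (wd x + ctr ξ) (wd y + ctr η) v = 0 := by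
  have h : ∀ v, Ac (wd X : Module.End R (ExteriorAlgebra R M)) (wd x + ctr ξ) v = ξ X • v := by
    intro v
    simp only [Ac, Module.End.mul_apply, LinearMap.add_apply,
      LinearMap.mulLeft_apply, ctr_ι_mul, mul_add, ← mul_assoc, ι_swap x X]
    simp
    abel
  rw [Qc_Ac, LinearMap.sub_apply, Module.End.mul_apply, Module.End.mul_apply, h, h, map_smul, sub_self]

lemma Q_cX (χ : Module.Dual R M) (x y : M) (ξ η : Module.Dual R M) (v) :
    Qc (ctr χ) (wd x + ctr ξ) (wd y + ctr η) v = 0 := by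
  have h : ∀ v, Ac (ctr χ) (wd x + ctr ξ) v = χ x • v := by
    intro v
    simp only [Ac, Module.End.mul_apply, LinearMap.add_apply,
      LinearMap.mulLeft_apply, ctr_ι_mul, map_add, ctr_comm χ ξ]
    abel
  rw [Qc_Ac, LinearMap.sub_apply, Module.End.mul_apply, Module.End.mul_apply, h, h, map_smul, sub_self]

lemma Q_tau {τ : ExteriorAlgebra R M} (hτ : τ ∈ ⋀[R]^3 M) (x y : M) (ξ η : Module.Dual R M) (v) :
    Qc (LinearMap.mulLeft R τ) (wd x + ctr ξ) (wd y + ctr η) v = - (ctr η (ctr ξ τ) * v) := by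
  have h : ∀ v, Ac (LinearMap.mulLeft R τ) (wd x + ctr ξ) v = ctr ξ τ * v := by
    intro v
    simp only [Ac, Module.End.mul_apply, LinearMap.add_apply,
      LinearMap.mulLeft_apply, ctr_mul ξ hτ, mul_add, ← mul_assoc, ι_comm hτ x]
    simp [pow_succ]
    abel
  have h2 := ctr_mem ξ hτ
  have h3 := ι_comm h2 y
  rw [Qc_Ac, LinearMap.sub_apply, Module.End.mul_apply, Module.End.mul_apply, h, h]
  simp only [LinearMap.add_apply, LinearMap.mulLeft_apply, ctr_mul η h2, mul_add, ← mul_assoc, h3]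
  simp

lemma Q_phi' {W : Type*} [AddCommGroup W] [Module R W] (p : W →ₗ[R] Module.Dual R M)
    {φ : ExteriorAlgebra R W} (hφ : φ ∈ ⋀[R]^3 W)
    (x y : M) (ξ η : W) (v) :
    Qc (pc p φ) (wd x + ctr (p ξ)) (wd y + ctr (p η)) v
      = ctr (p (ιInv (ctr (p.flip y) (ctr (p.flip x) φ)))) v := by
  have h : ∀ v, Ac (pc p φ) (wd x + ctr (p ξ)) v = pc p (ctr (p.flip x) φ) v := by
    intro v
    simp only [Ac, Module.End.mul_apply, LinearMap.add_apply,
      LinearMap.mulLeft_apply, map_add, pc_ι_mul p hφ, pc_ctr p hφ]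
    simp [pow_succ]
    abel
  have h2 : ctr (p.flip x) φ ∈ ⋀[R]^2 W := ctr_mem _ hφ
  have h1 : ctr (p.flip y) (ctr (p.flip x) φ) ∈ ⋀[R]^1 W := ctr_mem _ h2
  obtain ⟨ζ, hζ⟩ := mem1 h1
  rw [Qc_Ac, LinearMap.sub_apply, Module.End.mul_apply, Module.End.mul_apply, h, h]
  simp only [LinearMap.add_apply, LinearMap.mulLeft_apply, map_add, pc_ι_mul p h2, pc_ctr p h2]
  rw [hζ, ι_leftInverse, pc_ι]
  simp

/-- A second order operator of degree -1. -/
lemma Q_bv {B : Module.End R (ExteriorAlgebra R M)} (br : M →ₗ[R] M →ₗ[R] M)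
    (h1 : B 1 = 0) (hx : ∀ x, ∃ c : R, B (ι R x) = algebraMap R _ c)
    (hB : ∀ x y v, Qc B (wd x) (wd y) v = - (ι R (br x y) * v))
    (x y : M) (ξ η : Module.Dual R M) (v) :
    Qc B (wd x + ctr ξ) (wd y + ctr η) v = - (ι R (br x y) * v) + ctr (η ∘ₗ br x) v
      - ctr (ξ ∘ₗ br y) v := by
  have hwc : ∀ x η v, Qc B (wd x) (ctr η) v = ctr (η ∘ₗ br x) v := by
    intro x η v
    rw [← sub_eq_zero]
    refine end_ext (K := Qc B (wd x) (ctr η) - ctr (η ∘ₗ br x)) ?_ ?_ v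
    · obtain ⟨c, hc⟩ := hx x
      simp [Qc, ctr_one, h1, hc, ctr_algebraMap]
    · intro y v ih
      have h0 : (Qc B (wd x) (ctr η) - ctr (η ∘ₗ br x)) (ι R y * v)
         = - (ι R y * (Qc B (wd x) (ctr η) - ctr (η ∘ₗ br x)) v) := by
        have a1 := hB x y (ctr η v)
        have a2 := congrArg (ctr η) (hB x y v)
        simp only [Qc, LinearMap.sub_apply, Module.End.mul_apply, LinearMap.add_apply,
          LinearMap.mulLeft_apply, ctr_ι_mul, map_sub, map_smul, mul_add, mul_sub, map_add,
          map_neg, LinearMap.comp_apply, mul_smul_comm] at a1 a2 ⊢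
        linear_combination (norm := module) - a1 - a2
      rw [h0, ih, mul_zero, neg_zero]
  have hcw : ∀ y ξ v, Qc B (ctr ξ) (wd y) v = - ctr (ξ ∘ₗ br y) v := by
    intro y ξ v
    rw [← hwc]
    simp only [Qc, LinearMap.sub_apply, Module.End.mul_apply, LinearMap.add_apply,
          LinearMap.mulLeft_apply, ctr_ι_mul, map_sub, map_smul, mul_add, mul_sub, map_add,
          map_neg, LinearMap.comp_apply, mul_smul_comm]
    abel
  have hcc : ∀ ξ η v, Qc B (ctr ξ) (ctr η) v = 0 := by
    intro ξ η v
    refine end_ext ?_ ?_ v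
    · simp [Qc, ctr_one, h1]
    · intro y v ih
      have h0 : Qc B (ctr ξ) (ctr η) (ι R y * v)
         = - (ι R y * Qc B (ctr ξ) (ctr η) v) := by
        have a1 := hcw y ξ (ctr η v)
        have a2 := congrArg (ctr η) (hcw y ξ v)
        have a3 := ctr_comm (ξ ∘ₗ br y) η v
        simp only [Qc, LinearMap.sub_apply, Module.End.mul_apply, LinearMap.add_apply,
          LinearMap.mulLeft_apply, ctr_ι_mul, map_sub, map_smul, mul_add, mul_sub, map_add,
          map_neg, mul_smul_comm] at a1 a2 ⊢
        linear_combination (norm := module) - a1 - a2 + a3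
      rw [h0, ih, mul_zero, neg_zero]
  rw [Qc_expand]
  simp only [LinearMap.add_apply, hB, hwc, hcw, hcc]
  abel

end Pieces

section Phi
variable {R : Type*} {M : Type*} [CommRing R] [AddCommGroup M] [Module R M]

lemma mctrF_pc (φ : ExteriorAlgebra R (Module.Dual R M)) :
    (mctrF R M φ).unop = pc LinearMap.id φ := rfl

lemma mctrV_pc (r : ExteriorAlgebra R M) :
    (mctrV R M r).unop = pc (Module.Dual.eval R M) r := rfl

lemma Q_phi {φ : ExteriorAlgebra R (Module.Dual R M)} (hφ : φ ∈ ⋀[R]^3 (Module.Dual R M))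
    (x y : M) (ξ η : Module.Dual R M) (v) :
    Qc (mctrF R M φ).unop (wd x + ctr ξ) (wd y + ctr η) v
      = ctr (ιInv (ctrv y (ctrv x φ))) v := by
  rw [mctrF_pc, ← flip_id_ctr, ← flip_id_ctr]
  have := Q_phi' LinearMap.id hφ x y ξ η v
  rw [LinearMap.id_apply, LinearMap.id_apply, LinearMap.id_apply] at this
  exact this

end Phi

section BV
variable {K M W : Type*} [Field K] [AddCommGroup M] [Module K M]
  [AddCommGroup W] [Module K W]

lemma hom_ext_zero {A B : Module.End K (ExteriorAlgebra K M)}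
    (h : ∀ k r, r ∈ ⋀[K]^k M → A r = B r) (v) : A v = B v := by
  induction v using DirectSum.Decomposition.inductionOn (fun i : ℕ => ⋀[K]^i M) with
  | zero => simp
  | homogeneous m => exact h _ _ m.2
  | add x y hx hy => rw [map_add, map_add, hx, hy]

lemma zs (N : ℕ) (v : ExteriorAlgebra K M) :
    (-(-1 : ℤ)^N) • v = (-(-1 : K)^N) • v := by
  rcases Nat.even_or_odd N with h | h <;> simp [h.neg_one_pow]

variable [FiniteDimensional K M] [FiniteDimensional K W]
  {n : ℕ} (hn : Module.finrank K M = n) (hnW : Module.finrank K W = n)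
  (p : W →ₗ[K] Module.Dual K M) (pf : M →ₗ[K] Module.Dual K W)
  (hp : p.flip = pf)
  {dA : Module.End K (ExteriorAlgebra K W)}
  (hdeg : ∀ k ω, ω ∈ ⋀[K]^k W → dA ω ∈ ⋀[K]^(k+1) W)
  {Ω : ExteriorAlgebra K W} (hΩ : Ω ∈ ⋀[K]^n W)
  {Vt : ExteriorAlgebra K M} (hVt : Vt ∈ ⋀[K]^n M)
  (hone : pc p Ω Vt = 1)
  {B : Module.End K (ExteriorAlgebra K M)}
  (hB : ∀ (k : ℕ) r, r ∈ ⋀[K]^k M →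
      B r = (-(-1 : ℤ) ^ (n * (k + 1))) • pc p (dA (pc pf r Ω)) Vt)

include hn hp hVt in
lemma V_ι {m : ℕ} {ω : ExteriorAlgebra K W} (hω : ω ∈ ⋀[K]^m W) (x : M) :
    ι K x * pc p ω Vt = (-1 : K)^(m+1) • pc p (ctr (pf x) ω) Vt := by
  have h := pc_ι_mul p hω x Vt
  rw [extPow_eq_zero (by omega) (ι_mul_mem x hVt), map_zero, hp] at h
  have h' := (eq_neg_of_add_eq_zero_right h.symm)
  rw [h', smul_neg, smul_smul, ← pow_add, show m + 1 + m = 2 * m + 1 by ring, pow_succ, pow_mul]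
  simp

lemma F_ι {k : ℕ} {r : ExteriorAlgebra K M} (hr : r ∈ ⋀[K]^k M) (x : M) :
    pc pf (ι K x * r) Ω = (-1 : K)^k • ctr (pf x) (pc pf r Ω) := by
  rw [ι_comm hr, pc_smul, LinearMap.smul_apply, pc_mul, pc_ι]

include hn hp hVt hΩ hone in
lemma V_F {k : ℕ} {r : ExteriorAlgebra K M} (hr : r ∈ ⋀[K]^k M) :
    pc p (pc pf r Ω) Vt = (-1 : K)^((n+1)*k) • r := by
  refine deg_ind (P := fun k r => pc p (pc pf r Ω) Vt = (-1 : K)^((n+1)*k) • r) ?_ ?_ ?_ hr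
  · intro c
    rw [pc_algebraMap, LinearMap.smul_apply, pc_smul, LinearMap.smul_apply, Module.End.one_apply,
      hone, Algebra.algebraMap_eq_smul_one]
    simp
  · intro k a b ha hb
    rw [pc_add, LinearMap.add_apply, pc_add, LinearMap.add_apply, ha, hb, smul_add]
  · intro k x r hr ih
    rcases le_or_gt k n with hk | hk
    · obtain ⟨m, rfl⟩ := Nat.exists_eq_add_of_le' hk
      have hF : pc pf r Ω ∈ ⋀[K]^m W := pc_mem pf hr m Ω hΩ
      have h := V_ι hn p pf hp hVt hF x
      rw [ih, mul_smul_comm] at h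
      rw [F_ι pf hr, pc_smul, LinearMap.smul_apply]
      have h2 : pc p (ctr (pf x) (pc pf r Ω)) Vt
          = (-1 : K)^(m+1) • (-1 : K)^((m + k + 1)*k) • (ι K x * r) := by
        rw [h, smul_smul, ← mul_pow]; simp
      rw [h2, smul_smul, smul_smul, mul_add, mul_one, pow_add _ _ (m+k+1)]
      congr 1
      ring
    · rw [extPow_eq_zero (by omega) hr]
      simp [pc_zero]

include hnW hdeg hΩ hB in
lemma B_one : B 1 = 0 := by
  have h1 : (1 : ExteriorAlgebra K M) ∈ ⋀[K]^0 M := by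
    simpa using algebraMap_mem0 (1 : K)
  have h2 : pc pf (1 : ExteriorAlgebra K M) Ω = Ω := by
    simp [pc]
  rw [hB 0 1 h1, h2, extPow_eq_zero (by omega) (hdeg _ _ hΩ), pc_zero]
  simp

include hn hdeg hΩ hVt hB in
lemma B_ι (x : M) : ∃ c : K, B (ι K x) = algebraMap K _ c := by
  rcases n with _ | m
  · refine ⟨0, ?_⟩
    rw [extPow_eq_zero (by omega) (ι_mem x)]
    simp
  · apply mem0
    rw [hB 1 _ (ι_mem x)]
    refine zsmul_mem ?_ _
    refine pc_mem p (hdeg _ _ (pc_mem pf (ι_mem x) m Ω hΩ)) 0 _ ?_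
    rwa [zero_add]

include hn hp hdeg hΩ hVt hone hB in
lemma B_ww (br : M →ₗ[K] M →ₗ[K] M)
    (hL : ∀ x y ω, Qc dA (ctr (pf x)) (ctr (pf y)) ω = ctr (pf (br x y)) ω)
    (x y : M) (v) : Qc B (wd x) (wd y) v = - (ι K (br x y) * v) := by
  refine hom_ext_zero (B := - wd (br x y)) ?_ v
  intro k r hr
  rcases le_or_gt k n with hk | hk
  swap
  · rw [extPow_eq_zero (by omega) hr]
    simp
  obtain ⟨m, rfl⟩ := Nat.exists_eq_add_of_le' hk
  have hF : pc pf r Ω ∈ ⋀[K]^m W := pc_mem pf hr m Ω hΩ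
  have hVF := V_F hn p pf hp hΩ hVt hone hr
  have hyr := ι_mul_mem y hr
  have hxr := ι_mul_mem x hr
  have hxyr := ι_mul_mem x hyr
  have Fy := F_ι (Ω := Ω) pf hr y
  have Fx := F_ι (Ω := Ω) pf hr x
  have Fxy := F_ι (Ω := Ω) pf hyr x
  rw [Fy] at Fxy
  generalize hω : pc pf r Ω = ω at *
  have hd : ∀ z, dA (ctr (pf z) ω) ∈ ⋀[K]^m W := by
    intro z
    rcases m with _ | m
    · rw [ctr_mem0 _ hF]; simp
    · exact hdeg _ _ (ctr_mem _ hF)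
  have b1 := hB _ _ hxyr
  have b2 := hB _ _ hyr
  have b3 := hB _ _ hxr
  have b4 := hB _ _ hr
  have c1 := V_ι hn p pf hp hVt (hd y) x
  have c2 := V_ι hn p pf hp hVt (hd x) y
  have c3 := V_ι hn p pf hp hVt (hdeg _ _ hF) x
  have c4 := V_ι hn p pf hp hVt (ctr_mem (pf x) (hdeg _ _ hF)) y
  have c5 := V_ι hn p pf hp hVt hF (br x y)
  have l1 := congrArg (fun ω => pc p ω Vt) (hL x y ω)
  simp only [Qc, LinearMap.sub_apply, LinearMap.add_apply, Module.End.mul_apply, pc_add, pc_sub,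
    map_add] at l1
  simp only [Qc, LinearMap.sub_apply, LinearMap.add_apply, Module.End.mul_apply,
    LinearMap.mulLeft_apply, LinearMap.neg_apply]
  rw [Fxy] at b1
  rw [Fy] at b2
  rw [Fx] at b3
  rw [hω] at b4
  simp only [zs (K := K), map_smul, pc_smul, LinearMap.smul_apply] at b1 b2 b3 b4
  rw [b1, b2, b3, b4]
  simp only [mul_add (ι K y), mul_smul_comm, c1, c2, c3, c4]
  rw [hVF, mul_smul_comm, ← l1] at c5
  generalize pc p (dA (ctr (pf x) (ctr (pf y) ω))) Vt = a1 at *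
  generalize pc p (ctr (pf x) (dA (ctr (pf y) ω))) Vt = a2 at *
  generalize pc p (ctr (pf y) (dA (ctr (pf x) ω))) Vt = a3 at *
  generalize pc p (ctr (pf y) (ctr (pf x) (dA ω))) Vt = a4 at *
  generalize ι K (br x y) * r = z at *
  clear * - c5
  have e1 : (-1 : K)^((m+k+1)*k) = (-1 : K)^((m+k)*(k+1)) * (-1)^m := by
    have : (m+k)*(k+1) + m = (m+k+1)*k + 2 * m := by ring
    rw [← pow_add, this, pow_add, pow_mul _ 2]; simp
  have e2 : (-1 : K)^((m+k)*(k+1+1)) = (-1 : K)^((m+k)*(k+1)) * (-1)^m * (-1)^k := by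
    rw [← pow_add, ← pow_add]; congr 1; ring
  have e3 : (-1 : K)^((m+k)*(k+1+1+1)) = (-1 : K)^((m+k)*(k+1)) := by
    have : (m+k)*(k+1+1+1) = (m+k)*(k+1) + 2 * (m+k) := by ring
    rw [this, pow_add, pow_mul _ 2]; simp
  rw [e1] at c5
  rw [e2, e3]
  simp only [pow_succ (-1 : K) m, pow_succ (-1 : K) k, pow_succ (-1 : K) (m+1)] at c5 ⊢
  rcases neg_one_pow_eq_or K m with hm | hm <;> rcases neg_one_pow_eq_or K k with hk | hk <;>
  rcases neg_one_pow_eq_or K ((m+k)*(k+1)) with hs | hs <;>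
  rw [hm, hs] at c5 <;> rw [hm, hk, hs] <;> first | linear_combination (norm := module) (-1 : K) • c5 | linear_combination (norm := module) (1 : K) • c5
end BV

section Fin
variable {R : Type*} {M W : Type*} [CommRing R] [AddCommGroup M] [Module R M]
  [AddCommGroup W] [Module R W]

lemma pc_one_zero (p : W →ₗ[R] Module.Dual R M) {k : ℕ} {ω : ExteriorAlgebra R W}
    (h : ω ∈ ⋀[R]^(k+1) W) : pc p ω 1 = 0 := by
  have := deg_ind (P := fun k ω => 0 < k → pc p ω 1 = 0) ?_ ?_ ?_ h
  · exact this (Nat.succ_pos k)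
  · intro r hr; omega
  · intro k a b ha hb hk
    rw [pc_add, LinearMap.add_apply, ha hk, hb hk, add_zero]
  · intro k m a _ _ _
    rw [pc_mul, pc_ι, ctr_one, map_zero]

lemma pc_two (p : W →ₗ[R] Module.Dual R M) {ω : ExteriorAlgebra R W}
    (h : ω ∈ ⋀[R]^2 W) (x y : M) {c : R}
    (hc : ctr (p.flip y) (ctr (p.flip x) ω) = algebraMap R _ c) :
    pc p ω (ι R x * ι R y) = algebraMap R _ c := by
  have hx : ctr (p.flip x) ω ∈ ⋀[R]^1 W := ctr_mem _ h
  have hy : ctr (p.flip y) ω ∈ ⋀[R]^1 W := ctr_mem _ h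
  have e1 := pc_ι_mul p h x (ι R y)
  have e2 := pc_ι_mul p h y 1
  have e3 := pc_ι_mul p hx y 1
  rw [mul_one, pc_one_zero p h, pc_one_zero p hy] at e2
  rw [mul_one, pc_one_zero p hx, hc, pc_algebraMap] at e3
  rw [e1, e2, e3, Algebra.algebraMap_eq_smul_one]
  simp

lemma ctr_sub_left (a b : Module.Dual R M) (v) : ctr (a - b) v = ctr a v - ctr b v := by
  simp [ctr]

lemma ctr_add_left (a b : Module.Dual R M) (v) : ctr (a + b) v = ctr a v + ctr b v := by
  simp [ctr]

lemma epair_pc (ω : ExteriorAlgebra R (Module.Dual R M)) (r : ExteriorAlgebra R M) :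
    epair ω r = algebraMapInv (pc LinearMap.id ω r) := by
  rw [epair, mctrF_pc]

lemma flip_id_eval : (LinearMap.id : Module.Dual R M →ₗ[R] Module.Dual R M).flip
    = Module.Dual.eval R M := rfl

lemma der_hd {d : Module.End R (ExteriorAlgebra R M)}
    (hderiv : ∀ (k : ℕ) r s, r ∈ ⋀[R]^k M →
      d (r * s) = d r * s + ((-1 : ℤ) ^ k) • (r * d s)) (x : M) (s) :
    d (ι R x * s) = d (ι R x) * s - ι R x * d s := by
  rw [hderiv 1 _ s (ι_mem x), pow_one, neg_one_smul, sub_eq_add_neg]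

lemma dst_cc {d : Module.End R (ExteriorAlgebra R M)} (h1 : d 1 = 0)
    (hd : ∀ x s, d (ι R x * s) = d (ι R x) * s - ι R x * d s)
    (h2 : ∀ x, d (ι R x) ∈ ⋀[R]^2 M) (ξ η f : Module.Dual R M)
    (hgen : ∀ x, epair (ι R ξ * ι R η) (d (ι R x)) = - f x) (v) :
    Qc d (ctr ξ) (ctr η) v = ctr f v := by
  refine der_cc h1 hd h2 ξ η f ?_ v
  intro y
  obtain ⟨c, hc⟩ := mem0 (ctr_mem η (ctr_mem ξ (h2 y)))
  have h := hgen y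
  rw [epair_pc, pc_mul, pc_ι, pc_ι, LinearMap.id_apply, LinearMap.id_apply, hc,
    algebraMap_leftInverse] at h
  rw [hc, h, map_neg, neg_neg]

lemma dA_cc {d : Module.End R (ExteriorAlgebra R (Module.Dual R M))} (h1 : d 1 = 0)
    (hd : ∀ x s, d (ι R x * s) = d (ι R x) * s - ι R x * d s)
    (h2 : ∀ x, d (ι R x) ∈ ⋀[R]^2 (Module.Dual R M)) (x y z : M)
    (hgen : ∀ η : Module.Dual R M, epair (d (ι R η)) (ι R x * ι R y) = - η z) (v) :
    Qc d (ctr (Module.Dual.eval R M x)) (ctr (Module.Dual.eval R M y)) v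
      = ctr (Module.Dual.eval R M z) v := by
  refine der_cc h1 hd h2 _ _ _ ?_ v
  intro η
  obtain ⟨c, hc⟩ := mem0 (ctr_mem (Module.Dual.eval R M y)
    (ctr_mem (Module.Dual.eval R M x) (h2 η)))
  have h := hgen η
  rw [epair_pc, pc_two LinearMap.id (h2 η) x y (c := c) (by rw [flip_id_eval]; exact hc),
    algebraMap_leftInverse] at h
  rw [hc, h, map_neg, neg_neg, Module.Dual.eval_apply]
end Fin

/-- Let `D̂ = d_* − ∂ + (1/2)(X₀∧ + ι_{ξ₀}) + τ∧ − ι_φ` on `∧•g`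
for a proto-bialgebra `(g, g*, τ, φ)` over a point.  Then for all
`x + ξ, y + η ∈ g ⊕ g*`, the double graded commutator `[[D̂, x + ξ], y + η]`, as an
operator on `∧•g`, is the Clifford action of the element
`([x,y]_g + ad*_ξ y − ad*_η x − ι_ηι_ξτ) + ([ξ,η]_* + ad*_x η − ad*_y ξ − ι_yι_xφ)`
of `g ⊕ g*`, i.e. the derived bracket of `D̂` recovers the Dorfman bracket of the
quadratic Lie algebra `g ⊕ g*`.  (Here `ad*_ξ y = ι_ξ d_*(y)` and
`(ad*_x η)(y) = −η([x,y]_g)`; elements of `g` act by wedging and elements of `g*` by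
contraction.) -/
theorem derived_bracket_is_dorfman
    [FiniteDimensional ℝ g] (n : ℕ) (hn : Module.finrank ℝ g = n)
    -- the two skew-symmetric brackets
    (brA : g →ₗ[ℝ] g →ₗ[ℝ] g) (hskewA : ∀ x y, brA x y = - brA y x)
    (brD : Module.Dual ℝ g →ₗ[ℝ] Module.Dual ℝ g →ₗ[ℝ] Module.Dual ℝ g)
    (hskewD : ∀ ξ η, brD ξ η = - brD η ξ)
    -- τ and φ
    (τ : ExteriorAlgebra ℝ g) (hτ : τ ∈ ⋀[ℝ]^3 g)
    (φ : ExteriorAlgebra ℝ (Module.Dual ℝ g)) (hφ : φ ∈ ⋀[ℝ]^3 (Module.Dual ℝ g))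
    -- the Chevalley–Eilenberg-type differential d_* of g* acting on ∧•g
    (dst : Module.End ℝ (ExteriorAlgebra ℝ g))
    (hdst_one : dst 1 = 0)
    (hdst_gen : ∀ (x : g) (ξ η : Module.Dual ℝ g),
      epair (ι ℝ ξ * ι ℝ η) (dst (ι ℝ x)) = - (brD ξ η) x)
    (hdst_deg : ∀ (k : ℕ) r, r ∈ ⋀[ℝ]^k g → dst r ∈ ⋀[ℝ]^(k+1) g)
    (hdst_deriv : ∀ (k : ℕ) r s, r ∈ ⋀[ℝ]^k g →
      dst (r * s) = dst r * s + ((-1 : ℤ) ^ k) • (r * dst s))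
    -- the Chevalley–Eilenberg differential d_A of g acting on ∧•g*
    (dA : Module.End ℝ (ExteriorAlgebra ℝ (Module.Dual ℝ g)))
    (hdA_one : dA 1 = 0)
    (hdA_gen : ∀ (η : Module.Dual ℝ g) (x y : g),
      epair (dA (ι ℝ η)) (ι ℝ x * ι ℝ y) = - η (brA x y))
    (hdA_deg : ∀ (k : ℕ) ω, ω ∈ ⋀[ℝ]^k (Module.Dual ℝ g) →
      dA ω ∈ ⋀[ℝ]^(k+1) (Module.Dual ℝ g))
    (hdA_deriv : ∀ (k : ℕ) ω σ, ω ∈ ⋀[ℝ]^k (Module.Dual ℝ g) →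
      dA (ω * σ) = dA ω * σ + ((-1 : ℤ) ^ k) • (ω * dA σ))
    -- the Schouten extension of the g-bracket, used in the mixed axiom
    (Sch : ExteriorAlgebra ℝ g → ExteriorAlgebra ℝ g → ExteriorAlgebra ℝ g)
    (hSch_gen : ∀ x y : g, Sch (ι ℝ x) (ι ℝ y) = ι ℝ (brA x y))
    (hSch_fun : ∀ (x : g) (r : ℝ),
      Sch (ι ℝ x) (algebraMap ℝ (ExteriorAlgebra ℝ g) r) = 0)
    (hSch_addl : ∀ r s t, Sch (r + s) t = Sch r t + Sch s t)
    (hSch_addr : ∀ r s t, Sch r (s + t) = Sch r s + Sch r t)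
    (hSch_skew : ∀ (k l : ℕ) r s, r ∈ ⋀[ℝ]^k g → s ∈ ⋀[ℝ]^l g →
      Sch r s = (-(-1 : ℤ) ^ ((k + 1) * (l + 1))) • Sch s r)
    (hSch_deriv : ∀ (k l : ℕ) r s t, r ∈ ⋀[ℝ]^k g → s ∈ ⋀[ℝ]^l g →
      Sch r (s * t) = Sch r s * t + ((-1 : ℤ) ^ ((k + 1) * l)) • (s * Sch r t))
    -- the proto-bialgebra axioms (Definition 4.2, over a point)
    (ax1 : ∀ x y z : g,
      ι ℝ (brA (brA x y) z + brA (brA y z) x + brA (brA z x) y)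
        = (mctrF ℝ g φ).unop (dst (ι ℝ x * ι ℝ y * ι ℝ z)))
    (ax2 : ∀ ξ η χ : Module.Dual ℝ g,
      ι ℝ (brD (brD ξ η) χ + brD (brD η χ) ξ + brD (brD χ ξ) η)
        = (mctrV ℝ g τ).unop (dA (ι ℝ ξ * ι ℝ η * ι ℝ χ)))
    (ax3 : ∀ x y : g,
      dst (ι ℝ (brA x y))
        = Sch (dst (ι ℝ x)) (ι ℝ y) + Sch (ι ℝ x) (dst (ι ℝ y))
          + (mctrF ℝ g (ctrv y (ctrv x φ))).unop τ)
    (ax4 : dA φ = 0)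
    (ax5 : dst τ = 0)
    -- dual volume elements
    (Ω : ExteriorAlgebra ℝ (Module.Dual ℝ g)) (hΩ : Ω ∈ ⋀[ℝ]^n (Module.Dual ℝ g))
    (Vt : ExteriorAlgebra ℝ g) (hVt : Vt ∈ ⋀[ℝ]^n g)
    (hpair : epair Ω Vt = 1)
    -- the BV operator of the g-bracket
    (bv : Module.End ℝ (ExteriorAlgebra ℝ g))
    (hbv : ∀ (k : ℕ) r, r ∈ ⋀[ℝ]^k g →
      bv r = (-(-1 : ℤ) ^ (n * (k + 1))) • vsharp Vt (dA (osharp Ω r)))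
    -- the modular elements:  ⟨X₀|ξ⟩ = trace(ad_ξ)  and  ⟨ξ₀|x⟩ = trace(ad_x)
    (X₀ : g) (hX₀ : ∀ ξ, LinearMap.trace ℝ (Module.Dual ℝ g) (brD ξ) = ξ X₀)
    (ξ₀ : Module.Dual ℝ g) (hξ₀ : ∀ x, LinearMap.trace ℝ g (brA x) = ξ₀ x)
    -- the Dirac generating operator D̂
    (Dh : Module.End ℝ (ExteriorAlgebra ℝ g))
    (hDh : Dh = dst - bv
      + (1/2 : ℝ) • (LinearMap.mulLeft ℝ (ι ℝ X₀) + ctr ξ₀)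
      + LinearMap.mulLeft ℝ τ - (mctrF ℝ g φ).unop)
    -- the two Clifford sections
    (x y : g) (ξ η : Module.Dual ℝ g)
    (e₁ e₂ : Module.End ℝ (ExteriorAlgebra ℝ g))
    (he₁ : e₁ = LinearMap.mulLeft ℝ (ι ℝ x) + ctr ξ)
    (he₂ : e₂ = LinearMap.mulLeft ℝ (ι ℝ y) + ctr η)
    -- the components of the Dorfman bracket (x+ξ) ∘ (y+η)
    (gpart : ExteriorAlgebra ℝ g)
    (hgpart : gpart = ι ℝ (brA x y) + ctr ξ (dst (ι ℝ y)) - ctr η (dst (ι ℝ x))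
      - ctr η (ctr ξ τ))
    (dpart : Module.Dual ℝ g)
    (hdpart : dpart = brD ξ η - η ∘ₗ (brA x) + ξ ∘ₗ (brA y)
      - ιInv (ctrv y (ctrv x φ))) :
    -- [[D̂, e₁], e₂] is the Clifford action of the Dorfman bracket
    ∀ v : ExteriorAlgebra ℝ g,
      ((Dh * e₁ + e₁ * Dh) * e₂ - e₂ * (Dh * e₁ + e₁ * Dh)) v
        = gpart * v + ctr dpart v := by


  intro v
  have hd := der_hd hdst_deriv
  have h2 : ∀ x, dst (ι ℝ x) ∈ ⋀[ℝ]^2 g := fun x => hdst_deg 1 _ (ι_mem x)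
  have hdA := der_hd hdA_deriv
  have hA2 : ∀ η, dA (ι ℝ η) ∈ ⋀[ℝ]^2 (Module.Dual ℝ g) := fun x => hdA_deg 1 _ (ι_mem x)
  have hL : ∀ x y ω, Qc dA (ctr (Module.Dual.eval ℝ g x)) (ctr (Module.Dual.eval ℝ g y)) ω
      = ctr (Module.Dual.eval ℝ g (brA x y)) ω := fun x y ω =>
    dA_cc hdA_one hdA hA2 x y _ (fun η => hdA_gen η x y) ω
  have hnW : Module.finrank ℝ (Module.Dual ℝ g) = n := by
    rw [Subspace.dual_finrank_eq, hn]
  have hone : pc LinearMap.id Ω Vt = 1 := by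
    obtain ⟨c, hc⟩ := mem0 (pc_mem LinearMap.id hΩ 0 Vt (by rwa [zero_add]))
    rw [epair_pc, hc, algebraMap_leftInverse] at hpair
    rw [hc, hpair, map_one]
  have hB : ∀ (k : ℕ) r, r ∈ ⋀[ℝ]^k g →
      bv r = (-(-1 : ℤ) ^ (n * (k + 1))) • pc LinearMap.id
        (dA (pc (Module.Dual.eval ℝ g) r Ω)) Vt := by
    intro k r hr
    rw [hbv k r hr, vsharp, osharp, mctrF_pc, mctrV_pc]
  have hb := Q_bv brA
    (B_one hnW LinearMap.id (Module.Dual.eval ℝ g) hdA_deg hΩ hB)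
    (B_ι hn LinearMap.id (Module.Dual.eval ℝ g) hdA_deg hΩ hVt hB)
    (B_ww hn LinearMap.id (Module.Dual.eval ℝ g) flip_id_eval hdA_deg hΩ hVt hone hB brA hL)
    x y ξ η v
  have hs : Qc dst (wd x + ctr ξ) (wd y + ctr η) v
      = - (ctr η (dst (ι ℝ x)) * v) + ctr ξ (dst (ι ℝ y)) * v + ctr (brD ξ η) v := by
    rw [Qc_expand, LinearMap.add_apply, LinearMap.add_apply, LinearMap.add_apply,
      der_ww hd h2, der_wc hd h2, der_cw hd h2,
      dst_cc hdst_one hd h2 ξ η (brD ξ η) (fun x => hdst_gen x ξ η), zero_add]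
  have ht := Q_tau hτ x y ξ η v
  have hp := Q_phi hφ x y ξ η v
  have hw := Q_wX X₀ x y ξ η v
  have hc := Q_cX ξ₀ x y ξ η v
  change Qc Dh e₁ e₂ v = _
  rw [he₁, he₂, hDh, Qc_sub, Qc_add, Qc_add, Qc_sub, Qc_smul, Qc_add,
    LinearMap.sub_apply, LinearMap.add_apply, LinearMap.add_apply, LinearMap.sub_apply,
    LinearMap.smul_apply, LinearMap.add_apply, hs, hb, ht, hp, hw, hc, hgpart, hdpart,
    ctr_sub_left, ctr_add_left, ctr_sub_left, sub_mul, sub_mul, add_mul, add_zero, smul_zero]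
  abel

end Stmt19
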